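/- Quasi-normal-deduction completeness of DC: if α ⊨ β (every interpretation verifying α verifies β) then there exists a quasi-normal DC-deduction of β from α, i.e. one consisting of a quasi-analytic part (analytic rules and S-rules) followed by a quasi-synthetic part (synthetic rules and S-rules); moreover such a deduction exists in which the rule Exp is not used in the quasi-analytic part. -/

import Mathlib

/-- Formulas of classical propositional logic: propositional variables,
negation, conjunction, disjunction. -/
inductive Fml : Type
  | var : ℕ → Fml
  | neg : Fml → Fml
  | conj : Fml → Fml → Fml
  | disj : Fml → Fml → Fml
  deriving DecidableEq

/-- A datum: a finite set of finite sets (components) of formulas. -/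
abbrev Datum := Finset (Finset Fml)

/-- Truth-value of a formula under an interpretation of the variables. -/
def Fml.eval (v : ℕ → Bool) : Fml → Bool
  | .var n => v n
  | .neg A => !A.eval v
  | .conj A B => A.eval v && B.eval v
  | .disj A B => A.eval v || B.eval v

/-- An interpretation verifies a datum iff some component has all its
formulas true. -/
def Verifies (v : ℕ → Bool) (α : Datum) : Prop :=
  ∃ Γ ∈ α, ∀ A ∈ Γ, A.eval v = true

/-- The analytic G-rules of the Data Calculus DC. -/
inductive GStep : Datum → Datum → Prop
  | conj (Γ : Finset Fml) (A B : Fml) (ρ : Datum) :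
      GStep (insert (insert (Fml.conj A B) Γ) ρ)
            (insert (insert A (insert B Γ)) ρ)
  | disj (Γ : Finset Fml) (A B : Fml) (ρ : Datum) :
      GStep (insert (insert (Fml.disj A B) Γ) ρ)
            (insert (insert A Γ) (insert (insert B Γ) ρ))
  | negneg (Γ : Finset Fml) (A : Fml) (ρ : Datum) :
      GStep (insert (insert (Fml.neg (Fml.neg A)) Γ) ρ)
            (insert (insert A Γ) ρ)
  | negdisj (Γ : Finset Fml) (A B : Fml) (ρ : Datum) :
      GStep (insert (insert (Fml.neg (Fml.disj A B)) Γ) ρ)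
            (insert (insert (Fml.neg A) (insert (Fml.neg B) Γ)) ρ)
  | negconj (Γ : Finset Fml) (A B : Fml) (ρ : Datum) :
      GStep (insert (insert (Fml.neg (Fml.conj A B)) Γ) ρ)
            (insert (insert (Fml.neg A) Γ) (insert (insert (Fml.neg B) Γ) ρ))

/-- The analytic N-rule NC: delete a component containing a pair A, ¬A. -/
def NCStep (α β : Datum) : Prop :=
  ∃ (Γ : Finset Fml) (A : Fml),
    α = insert (insert A (insert (Fml.neg A) Γ)) β

/-- The synthetic N-rule EM: replace a component Γ by the two components
Γ∪{A} and Γ∪{¬A}. -/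
def EMStep (α β : Datum) : Prop :=
  ∃ (Γ : Finset Fml) (A : Fml) (ρ : Datum),
    α = insert Γ ρ ∧
    β = insert (insert A Γ) (insert (insert (Fml.neg A) Γ) ρ)

/-- The analytic S-rule Del: replace a component Γ∪Δ by its subset Γ. -/
def DelStep (α β : Datum) : Prop :=
  ∃ (Γ Δ : Finset Fml) (ρ : Datum),
    α = insert (Γ ∪ Δ) ρ ∧ β = insert Γ ρ

/-- The synthetic S-rule Exp: add an arbitrary new component. -/
def ExpStep (α β : Datum) : Prop :=
  ∃ Γ : Finset Fml, β = insert Γ α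

abbrev AStep : Datum → Datum → Prop := fun x y => GStep x y ∨ NCStep x y ∨ DelStep x y
abbrev SStep : Datum → Datum → Prop :=
  fun x y => GStep y x ∨ EMStep x y ∨ DelStep x y ∨ ExpStep x y

def Elim (β : Datum) (Γ : Finset Fml) : Prop :=
  ∀ ρ : Datum, β ⊆ ρ → Relation.ReflTransGen SStep (insert Γ ρ) ρ

theorem Elim.mono {β : Datum} {Γ Δ : Finset Fml} (h : Γ ⊆ Δ) (e : Elim β Γ) : Elim β Δ := by
  intro ρ hρ
  refine Relation.ReflTransGen.head (b := insert Γ ρ) ?_ (e ρ hρ)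
  exact Or.inr (Or.inr (Or.inl ⟨Γ, Δ, ρ, by rw [Finset.union_eq_right.2 h], rfl⟩))

theorem Elim.of_mem {β : Datum} {Γ : Finset Fml} (h : Γ ∈ β) : Elim β Γ := by
  intro ρ hρ
  rw [Finset.insert_eq_of_mem (hρ h)]

theorem Elim.em {β : Datum} {Γ : Finset Fml} (A : Fml) (h1 : Elim β (insert A Γ))
    (h2 : Elim β (insert (Fml.neg A) Γ)) : Elim β Γ := by
  intro ρ hρ
  refine Relation.ReflTransGen.head
    (b := insert (insert A Γ) (insert (insert (Fml.neg A) Γ) ρ)) ?_ ?_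
  · exact Or.inr (Or.inl ⟨Γ, A, ρ, rfl, rfl⟩)
  · exact (h1 _ (hρ.trans (Finset.subset_insert _ _))).trans (h2 ρ hρ)

theorem Elim.one {β : Datum} {Γ : Finset Fml} {C : Fml}
    (hs : ∀ ρ, GStep (insert (insert C Γ) ρ) (insert Γ ρ))
    (e : Elim β (insert C Γ)) : Elim β Γ := by
  intro ρ hρ
  exact Relation.ReflTransGen.head (Or.inl (hs ρ)) (e ρ hρ)

theorem Elim.two {β : Datum} {Γ : Finset Fml} {C : Fml} (D : Finset Fml)
    (hs : ∀ ρ, GStep (insert (insert C Γ) ρ) (insert D (insert Γ ρ)))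
    (e : Elim β (insert C Γ)) : Elim β Γ := by
  intro ρ hρ
  refine Relation.ReflTransGen.head (b := insert D (insert Γ ρ)) ?_ ?_
  · exact Or.inr (Or.inr (Or.inr ⟨D, rfl⟩))
  exact Relation.ReflTransGen.head (Or.inl (hs ρ)) (e ρ hρ)

theorem Elim.conj {β : Datum} {Γ : Finset Fml} {A B : Fml} (hA : A ∈ Γ) (hB : B ∈ Γ)
    (e : Elim β (insert (Fml.conj A B) Γ)) : Elim β Γ := by
  refine Elim.one (fun ρ => ?_) e
  have := GStep.conj Γ A B ρ
  rwa [Finset.insert_eq_of_mem hB, Finset.insert_eq_of_mem hA] at this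

theorem Elim.negdisj {β : Datum} {Γ : Finset Fml} {A B : Fml} (hA : Fml.neg A ∈ Γ)
    (hB : Fml.neg B ∈ Γ)
    (e : Elim β (insert (Fml.neg (Fml.disj A B)) Γ)) : Elim β Γ := by
  refine Elim.one (fun ρ => ?_) e
  have := GStep.negdisj Γ A B ρ
  rwa [Finset.insert_eq_of_mem hB, Finset.insert_eq_of_mem hA] at this

theorem Elim.negneg {β : Datum} {Γ : Finset Fml} {A : Fml} (hA : A ∈ Γ)
    (e : Elim β (insert (Fml.neg (Fml.neg A)) Γ)) : Elim β Γ := by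
  refine Elim.one (fun ρ => ?_) e
  have := GStep.negneg Γ A ρ
  rwa [Finset.insert_eq_of_mem hA] at this

theorem Elim.disj {β : Datum} {Γ : Finset Fml} {A B : Fml} (h : A ∈ Γ ∨ B ∈ Γ)
    (e : Elim β (insert (Fml.disj A B) Γ)) : Elim β Γ := by
  rcases h with h | h
  · refine Elim.two (insert B Γ) (fun ρ => ?_) e
    have := GStep.disj Γ A B ρ
    rwa [Finset.insert_eq_of_mem h, Finset.insert_comm] at this
  · refine Elim.two (insert A Γ) (fun ρ => ?_) e
    have := GStep.disj Γ A B ρ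
    rwa [Finset.insert_eq_of_mem h] at this

theorem Elim.negconj {β : Datum} {Γ : Finset Fml} {A B : Fml}
    (h : Fml.neg A ∈ Γ ∨ Fml.neg B ∈ Γ)
    (e : Elim β (insert (Fml.neg (Fml.conj A B)) Γ)) : Elim β Γ := by
  rcases h with h | h
  · refine Elim.two (insert (Fml.neg B) Γ) (fun ρ => ?_) e
    have := GStep.negconj Γ A B ρ
    rwa [Finset.insert_eq_of_mem h, Finset.insert_comm] at this
  · refine Elim.two (insert (Fml.neg A) Γ) (fun ρ => ?_) e
    have := GStep.negconj Γ A B ρ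
    rwa [Finset.insert_eq_of_mem h] at this

def Fml.bd : Fml → ℕ
  | .var n => n + 1
  | .neg A => A.bd
  | .conj A B => max A.bd B.bd
  | .disj A B => max A.bd B.bd

def Lits (v : ℕ → Bool) (N : ℕ) (Γ : Finset Fml) : Prop :=
  ∀ i < N, (v i = true → Fml.var i ∈ Γ) ∧ (v i = false → Fml.neg (Fml.var i) ∈ Γ)

theorem Lits.mono {v : ℕ → Bool} {N M : ℕ} {Γ Δ : Finset Fml} (h : Lits v N Γ) (hM : M ≤ N)
    (hs : Γ ⊆ Δ) : Lits v M Δ :=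
  fun i hi => ⟨fun e => hs ((h i (by omega)).1 e), fun e => hs ((h i (by omega)).2 e)⟩

theorem Elim.add_true {β : Datum} (v : ℕ → Bool) (A : Fml) :
    ∀ Γ : Finset Fml, Lits v A.bd Γ →
      (A.eval v = true → Elim β (insert A Γ) → Elim β Γ) ∧
      (A.eval v = false → Elim β (insert (Fml.neg A) Γ) → Elim β Γ) := by
  induction A with
  | var n =>
    intro Γ hΓ
    have := hΓ n (Nat.lt_succ_self n)
    constructor
    · intro h e
      rwa [Finset.insert_eq_of_mem (this.1 h)] at e
    · intro h e
      rwa [Finset.insert_eq_of_mem (this.2 h)] at e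
  | neg A ih =>
    intro Γ hΓ
    constructor
    · intro h e
      exact (ih Γ hΓ).2 (by simpa [Fml.eval] using h) e
    · intro h e
      refine (ih Γ hΓ).1 (by simpa [Fml.eval] using h) ?_
      exact Elim.negneg (Finset.mem_insert_self _ _)
        (e.mono (Finset.insert_subset_insert _ (Finset.subset_insert _ _)))
  | conj A B ihA ihB =>
    intro Γ hΓ
    have hA := ihA Γ (hΓ.mono (le_max_left _ _) subset_rfl)
    have hB := fun C => ihB (insert C Γ) (hΓ.mono (le_max_right _ _) (Finset.subset_insert _ _))
    have hB' := ihB Γ (hΓ.mono (le_max_right _ _) subset_rfl)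
    constructor
    · intro h e
      simp only [Fml.eval, Bool.and_eq_true] at h
      refine hA.1 h.1 ((hB _).1 h.2 (Elim.conj (A := A) (B := B) (by simp) (by simp) (e.mono ?_)))
      intro x; simp; tauto
    · intro h e
      simp only [Fml.eval, Bool.and_eq_false_iff] at h
      rcases h with h | h
      · refine hA.2 h (Elim.negconj (A := A) (B := B) (by simp) (e.mono ?_))
        intro x; simp; tauto
      · refine hB'.2 h (Elim.negconj (A := A) (B := B) (by simp) (e.mono ?_))
        intro x; simp; tauto
  | disj A B ihA ihB =>
    intro Γ hΓ
    have hA := ihA Γ (hΓ.mono (le_max_left _ _) subset_rfl)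
    have hB := fun C => ihB (insert C Γ) (hΓ.mono (le_max_right _ _) (Finset.subset_insert _ _))
    have hB' := ihB Γ (hΓ.mono (le_max_right _ _) subset_rfl)
    constructor
    · intro h e
      simp only [Fml.eval, Bool.or_eq_true] at h
      rcases h with h | h
      · refine hA.1 h (Elim.disj (A := A) (B := B) (by simp) (e.mono ?_))
        intro x; simp; tauto
      · refine hB'.1 h (Elim.disj (A := A) (B := B) (by simp) (e.mono ?_))
        intro x; simp; tauto
    · intro h e
      simp only [Fml.eval, Bool.or_eq_false_iff] at h
      refine hA.2 h.1 ((hB _).2 h.2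
        (Elim.negdisj (A := A) (B := B) (by simp) (by simp) (e.mono ?_)))
      intro x; simp; tauto

theorem Elim.add_set {β : Datum} (v : ℕ → Bool) (N : ℕ) (Δ : Finset Fml) :
    ∀ Γ : Finset Fml, Lits v N Γ → (∀ A ∈ Δ, A.bd ≤ N ∧ A.eval v = true) →
      Elim β (Δ ∪ Γ) → Elim β Γ := by
  induction Δ using Finset.induction_on with
  | empty => intro Γ _ _ e; simpa using e
  | insert A Δ _ ih =>
    intro Γ hΓ hΔ e
    have hA := hΔ A (Finset.mem_insert_self _ _)
    refine ih Γ hΓ (fun B hB => hΔ B (Finset.mem_insert_of_mem hB)) ?_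
    refine (Elim.add_true v A _ (hΓ.mono hA.1 Finset.subset_union_right)).1 hA.2 ?_
    rwa [Finset.insert_union] at e

def Agrees (v : ℕ → Bool) (Γ : Finset Fml) : Prop :=
  ∀ i, (Fml.var i ∈ Γ → v i = true) ∧ (Fml.neg (Fml.var i) ∈ Γ → v i = false)

def Cons (Γ : Finset Fml) : Prop :=
  ∀ i, ¬ (Fml.var i ∈ Γ ∧ Fml.neg (Fml.var i) ∈ Γ)

theorem Elim.main {β : Datum} (N : ℕ) (hN : ∀ Δ ∈ β, ∀ A ∈ Δ, A.bd ≤ N) (k : ℕ) :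
    ∀ Γ : Finset Fml, Cons Γ → (∀ v, Agrees v Γ → Verifies v β) →
      (∀ i, k ≤ i → i < N → Fml.var i ∈ Γ ∨ Fml.neg (Fml.var i) ∈ Γ) → Elim β Γ := by
  induction k with
  | zero =>
    intro Γ hc hv hd
    let v : ℕ → Bool := fun i => decide (Fml.var i ∈ Γ)
    have hag : Agrees v Γ := by
      intro i
      have := hc i
      simp only [v, decide_eq_true_eq, decide_eq_false_iff_not]
      tauto
    obtain ⟨Δ, hΔ, hs⟩ := hv v hag
    refine Elim.add_set v N Δ Γ ?_ (fun A hA => ⟨hN Δ hΔ A hA, hs A hA⟩)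
      ((Elim.of_mem hΔ).mono Finset.subset_union_left)
    intro i hi
    have := hd i (Nat.zero_le _) hi
    simp only [v, decide_eq_true_eq, decide_eq_false_iff_not]
    tauto
  | succ k ih =>
    intro Γ hc hv hd
    by_cases hk : Fml.var k ∈ Γ ∨ Fml.neg (Fml.var k) ∈ Γ
    · refine ih Γ hc hv (fun i hi hN => ?_)
      rcases Nat.eq_or_lt_of_le hi with rfl | h
      · exact hk
      · exact hd i h hN
    · push Not at hk
      refine Elim.em (Fml.var k) (ih _ ?_ ?_ ?_) (ih _ ?_ ?_ ?_)
      · intro i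
        have := hc i
        simp only [Finset.mem_insert, Fml.var.injEq, reduceCtorEq, false_or]
        rintro ⟨rfl | h, h'⟩
        · exact hk.2 h'
        · exact this ⟨h, h'⟩
      · intro v h
        exact hv v (fun i => ⟨fun h' => (h i).1 (Finset.mem_insert_of_mem h'),
          fun h' => (h i).2 (Finset.mem_insert_of_mem h')⟩)
      · intro i hi hN
        rcases Nat.eq_or_lt_of_le hi with rfl | h
        · simp
        · have := hd i h hN
          simp only [Finset.mem_insert]; tauto
      · intro i
        have := hc i
        simp only [Finset.mem_insert, Fml.neg.injEq, Fml.var.injEq, reduceCtorEq, false_or]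
        rintro ⟨h, rfl | h'⟩
        · exact hk.1 h
        · exact this ⟨h, h'⟩
      · intro v h
        exact hv v (fun i => ⟨fun h' => (h i).1 (Finset.mem_insert_of_mem h'),
          fun h' => (h i).2 (Finset.mem_insert_of_mem h')⟩)
      · intro i hi hN
        rcases Nat.eq_or_lt_of_le hi with rfl | h
        · simp
        · have := hd i h hN
          simp only [Finset.mem_insert]; tauto

theorem exp_all (β : Datum) : ∀ γ : Datum, Relation.ReflTransGen SStep γ (β ∪ γ) := by
  induction β using Finset.induction_on with
  | empty => intro γ; rw [Finset.empty_union]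
  | insert Γ β _ ih =>
    intro γ
    refine (ih γ).tail (Or.inr (Or.inr (Or.inr ⟨Γ, ?_⟩)))
    rw [Finset.insert_union]

theorem elim_all {β : Datum} (γ : Datum) :
    (∀ Γ ∈ γ, Elim β Γ) → Relation.ReflTransGen SStep (γ ∪ β) β := by
  induction γ using Finset.induction_on with
  | empty => intro _; rw [Finset.empty_union]
  | insert Γ γ _ ih =>
    intro h
    rw [Finset.insert_union]
    exact (h Γ (Finset.mem_insert_self _ _) _ Finset.subset_union_right).trans
      (ih (fun Δ hΔ => h Δ (Finset.mem_insert_of_mem hΔ)))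

def Fml.wt : Fml → ℕ
  | .var _ => 0
  | .neg A => A.wt + 1
  | .conj A B => A.wt + B.wt + 2
  | .disj A B => A.wt + B.wt + 2

def cwt (Γ : Finset Fml) : ℕ := ∑ A ∈ Γ, A.wt

theorem cwt_insert_le (A : Fml) (Γ : Finset Fml) : cwt (insert A Γ) ≤ A.wt + cwt Γ := by
  unfold cwt
  by_cases h : A ∈ Γ
  · rw [Finset.insert_eq_of_mem h]; omega
  · rw [Finset.sum_insert h]

def Sat (v : ℕ → Bool) (Γ : Finset Fml) : Prop := ∀ A ∈ Γ, A.eval v = true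

theorem sat_insert {v : ℕ → Bool} {A : Fml} {Γ : Finset Fml} :
    Sat v (insert A Γ) ↔ A.eval v = true ∧ Sat v Γ := by
  simp [Sat]

def Good (Γ : Finset Fml) : Prop := Cons Γ ∧ ∀ v, Agrees v Γ → Sat v Γ

def Red (Γ : Finset Fml) : Prop :=
  ∃ δ : Datum, (∀ Δ ∈ δ, Good Δ ∧ ∀ v, Sat v Δ → Sat v Γ) ∧
    ∀ ρ : Datum, Relation.ReflTransGen AStep (insert Γ ρ) (δ ∪ ρ)

theorem Red.one {Γ Γ' : Finset Fml} (hs : ∀ ρ, GStep (insert Γ ρ) (insert Γ' ρ))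
    (hv : ∀ v, Sat v Γ' → Sat v Γ) (h : Red Γ') : Red Γ := by
  obtain ⟨δ, h1, h2⟩ := h
  exact ⟨δ, fun Δ hΔ => ⟨(h1 Δ hΔ).1, fun v hh => hv v ((h1 Δ hΔ).2 v hh)⟩,
    fun ρ => Relation.ReflTransGen.head (Or.inl (hs ρ)) (h2 ρ)⟩

theorem Red.two {Γ Γ' Γ'' : Finset Fml}
    (hs : ∀ ρ, GStep (insert Γ ρ) (insert Γ' (insert Γ'' ρ)))
    (hv : ∀ v, Sat v Γ' → Sat v Γ) (hv' : ∀ v, Sat v Γ'' → Sat v Γ)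
    (h : Red Γ') (h' : Red Γ'') : Red Γ := by
  obtain ⟨δ, h1, h2⟩ := h
  obtain ⟨ε, h3, h4⟩ := h'
  refine ⟨ε ∪ δ, fun Δ hΔ => ?_, fun ρ => Relation.ReflTransGen.head (Or.inl (hs ρ)) ?_⟩
  · rcases Finset.mem_union.1 hΔ with hΔ | hΔ
    · exact ⟨(h3 Δ hΔ).1, fun v hh => hv' v ((h3 Δ hΔ).2 v hh)⟩
    · exact ⟨(h1 Δ hΔ).1, fun v hh => hv v ((h1 Δ hΔ).2 v hh)⟩
  · refine (h2 _).trans ?_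
    rw [Finset.union_insert, Finset.union_assoc]
    exact h4 _

def IsLit (A : Fml) : Prop := ∃ n, A = Fml.var n ∨ A = Fml.neg (Fml.var n)

theorem red_all (n : ℕ) : ∀ Γ : Finset Fml, cwt Γ < n → Red Γ := by
  induction n with
  | zero => intro Γ h; omega
  | succ n ih =>
    intro Γ hn
    by_cases hl : ∀ A ∈ Γ, IsLit A
    · by_cases hc : Cons Γ
      · refine ⟨{Γ}, fun Δ hΔ => ?_, fun ρ => by rw [Finset.insert_eq]⟩
        obtain rfl := Finset.mem_singleton.1 hΔ
        refine ⟨⟨hc, fun v hv A hA => ?_⟩, fun v hv => hv⟩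
        obtain ⟨m, rfl | rfl⟩ := hl A hA
        · exact (hv m).1 hA
        · simp [Fml.eval, (hv m).2 hA]
      · refine ⟨∅, by simp, fun ρ => ?_⟩
        unfold Cons at hc
        push Not at hc
        obtain ⟨i, h1, h2⟩ := hc
        refine Relation.ReflTransGen.single (Or.inr (Or.inl ⟨Γ, Fml.var i, ?_⟩))
        rw [Finset.insert_eq_of_mem h2, Finset.insert_eq_of_mem h1, Finset.empty_union]
    · push Not at hl
      obtain ⟨C, hC, hnl⟩ := hl
      obtain ⟨Θ, hΘ, hw⟩ : ∃ Θ, Γ = insert C Θ ∧ cwt Γ = C.wt + cwt Θ :=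
        ⟨Γ.erase C, (Finset.insert_erase hC).symm, (Finset.add_sum_erase _ _ hC).symm⟩
      subst hΘ
      rw [hw] at hn
      have i1 := fun A => cwt_insert_le A Θ
      have i2 := fun A B => cwt_insert_le A (insert B Θ)
      cases C with
      | var m => exact absurd ⟨m, Or.inl rfl⟩ hnl
      | conj A B =>
        simp only [Fml.wt] at hn
        refine Red.one (fun ρ => GStep.conj Θ A B ρ) (fun v => ?_) (ih _ ?_)
        · simp only [sat_insert, Fml.eval, Bool.and_eq_true]; tauto
        · have := i1 B; have := i2 A B; omega
      | disj A B =>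
        simp only [Fml.wt] at hn
        refine Red.two (fun ρ => GStep.disj Θ A B ρ) (fun v => ?_) (fun v => ?_)
          (ih _ ?_) (ih _ ?_)
        · simp only [sat_insert, Fml.eval, Bool.or_eq_true]; tauto
        · simp only [sat_insert, Fml.eval, Bool.or_eq_true]; tauto
        · have := i1 A; omega
        · have := i1 B; omega
      | neg D =>
        cases D with
        | var m => exact absurd ⟨m, Or.inr rfl⟩ hnl
        | neg A =>
          simp only [Fml.wt] at hn
          refine Red.one (fun ρ => GStep.negneg Θ A ρ) (fun v => ?_) (ih _ ?_)
          · simp only [sat_insert, Fml.eval, Bool.not_not]; tauto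
          · have := i1 A; omega
        | disj A B =>
          simp only [Fml.wt] at hn
          refine Red.one (fun ρ => GStep.negdisj Θ A B ρ) (fun v => ?_) (ih _ ?_)
          · simp only [sat_insert, Fml.eval, Bool.not_or, Bool.and_eq_true]; tauto
          · have := i1 B.neg; have := i2 A.neg B.neg
            simp only [Fml.wt] at *; omega
        | conj A B =>
          simp only [Fml.wt] at hn
          refine Red.two (fun ρ => GStep.negconj Θ A B ρ) (fun v => ?_) (fun v => ?_)
            (ih _ ?_) (ih _ ?_)
          · simp only [sat_insert, Fml.eval, Bool.not_and, Bool.or_eq_true]; tauto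
          · simp only [sat_insert, Fml.eval, Bool.not_and, Bool.or_eq_true]; tauto
          · have := i1 A.neg
            simp only [Fml.wt] at *; omega
          · have := i1 B.neg
            simp only [Fml.wt] at *; omega

theorem red_datum (α : Datum) :
    ∃ γ : Datum, (∀ Δ ∈ γ, Good Δ ∧ ∀ v, Sat v Δ → Verifies v α) ∧
      ∀ ρ : Datum, Relation.ReflTransGen AStep (α ∪ ρ) (γ ∪ ρ) := by
  induction α using Finset.induction_on with
  | empty => exact ⟨∅, by simp, fun ρ => Relation.ReflTransGen.refl⟩
  | insert Γ α _ ih =>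
    obtain ⟨γ, h1, h2⟩ := ih
    obtain ⟨δ, h3, h4⟩ := red_all _ Γ (Nat.lt_succ_self _)
    refine ⟨γ ∪ δ, fun Δ hΔ => ?_, fun ρ => ?_⟩
    · rcases Finset.mem_union.1 hΔ with hΔ | hΔ
      · refine ⟨(h1 Δ hΔ).1, fun v hv => ?_⟩
        obtain ⟨E, hE, hh⟩ := (h1 Δ hΔ).2 v hv
        exact ⟨E, Finset.mem_insert_of_mem hE, hh⟩
      · exact ⟨(h3 Δ hΔ).1, fun v hv => ⟨Γ, Finset.mem_insert_self _ _, (h3 Δ hΔ).2 v hv⟩⟩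
    · rw [Finset.insert_union]
      refine (h4 _).trans ?_
      have := h2 (δ ∪ ρ)
      rwa [Finset.union_left_comm, ← Finset.union_assoc γ] at this

theorem dc_second (α β : Datum)
    (h : ∀ v : ℕ → Bool, Verifies v α → Verifies v β) :
    ∃ γ : Datum, Relation.ReflTransGen AStep α γ ∧ Relation.ReflTransGen SStep γ β := by
  obtain ⟨γ, h1, h2⟩ := red_datum α
  refine ⟨γ, by simpa using h2 ∅, (exp_all β γ).trans ?_⟩
  rw [Finset.union_comm]
  refine elim_all γ (fun Γ hΓ => ?_)
  have hN : ∀ Δ ∈ β, ∀ A ∈ Δ, A.bd ≤ β.sup (fun Δ => Δ.sup Fml.bd) := fun Δ hΔ A hA =>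
    (Finset.le_sup (f := Fml.bd) hA).trans
      (Finset.le_sup (f := fun Δ : Finset Fml => Δ.sup Fml.bd) hΔ)
  obtain ⟨⟨hc, hg⟩, hs⟩ := h1 Γ hΓ
  exact Elim.main _ hN (β.sup (fun Δ => Δ.sup Fml.bd)) Γ hc (fun v hv => h v (hs v (hg v hv))) (fun i hi hi' => by omega)

/-- Quasi-normal-deduction completeness of DC: if α ⊨ β then there is a
quasi-normal DC-deduction of β from α, i.e. a quasi-analytic part (analytic
rules and S-rules) followed by a quasi-synthetic part (synthetic rules and
S-rules); moreover one in which Exp is not used in the quasi-analytic part. -/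
theorem dc_quasinormal_deduction_completeness (α β : Datum)
    (h : ∀ v : ℕ → Bool, Verifies v α → Verifies v β) :
    (∃ γ : Datum,
      Relation.ReflTransGen
        (fun x y => GStep x y ∨ NCStep x y ∨ DelStep x y ∨ ExpStep x y) α γ ∧
      Relation.ReflTransGen
        (fun x y => GStep y x ∨ EMStep x y ∨ DelStep x y ∨ ExpStep x y) γ β) ∧
    (∃ γ : Datum,
      Relation.ReflTransGen
        (fun x y => GStep x y ∨ NCStep x y ∨ DelStep x y) α γ ∧
      Relation.ReflTransGen
        (fun x y => GStep y x ∨ EMStep x y ∨ DelStep x y ∨ ExpStep x y) γ β) := by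
  have key := dc_second α β h
  refine ⟨?_, key⟩
  obtain ⟨γ, h1, h2⟩ := key
  refine ⟨γ, Relation.ReflTransGen.mono ?_ _ _ h1, h2⟩
  rintro x y (h | h | h)
  · exact Or.inl h
  · exact Or.inr (Or.inl h)
  · exact Or.inr (Or.inr (Or.inl h))
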